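/- Let A and B be n×n real symmetric positive semidefinite matrices all of whose diagonal entries equal 1/n (normalized kernel matrices), let α > 0 with α ≠ 1, and let k be an integer with 1 ≤ k ≤ n−1. Then the low-rank Rényi entropy of the normalized Hadamard product dominates both marginals: S_α^k( (A∘B)/tr(A∘B) ) ≥ max( S_α^k(A), S_α^k(B) ), where A∘B denotes the entrywise (Hadamard) product. -/

import Mathlib

open scoped BigOperators

/-- The eigenvalues of a real symmetric matrix, sorted in nonincreasing order
    (returns `0` if the matrix is not symmetric). -/
noncomputable def eigs {n : ℕ} (A : Matrix (Fin n) (Fin n) ℝ) : Fin n → ℝ :=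
  if h : A.IsHermitian then
    fun i => (h.eigenvalues ∘ Tuple.sort h.eigenvalues) i.rev
  else 0

/-- The sum of `f i` over the indices `i < k` (the `k` largest eigenvalues when
    `f` is nonincreasing). -/
noncomputable def topSum {n : ℕ} (k : ℕ) (f : Fin n → ℝ) : ℝ :=
  ∑ i ∈ Finset.univ.filter fun i : Fin n => (i : ℕ) < k, f i

/-- `λ_r(A) = (1 - ∑_{i=1}^k λ_i(A)) / (n - k)`. -/
noncomputable def lamR {n : ℕ} (k : ℕ) (A : Matrix (Fin n) (Fin n) ℝ) : ℝ :=
  (1 - topSum k (eigs A)) / ((n : ℝ) - (k : ℝ))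

/-- Low-rank matrix-based Rényi entropy
    `S_α^k(A) = (1/(1-α)) log₂(∑_{i=1}^k λ_i(A)^α + (n-k) λ_r(A)^α)`. -/
noncomputable def Slow {n : ℕ} (α : ℝ) (k : ℕ) (A : Matrix (Fin n) (Fin n) ℝ) : ℝ :=
  (1 / (1 - α)) * Real.logb 2
    (topSum k (fun i => eigs A i ^ α) + ((n : ℝ) - (k : ℝ)) * lamR k A ^ α)

/-- Matrix-based Rényi entropy `S_α(A) = (1/(1-α)) log₂(∑_{i=1}^n λ_i(A)^α)`. -/
noncomputable def Sfull {n : ℕ} (α : ℝ) (A : Matrix (Fin n) (Fin n) ℝ) : ℝ :=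
  (1 / (1 - α)) * Real.logb 2 (∑ i, eigs A i ^ α)

section topSum

variable {n : ℕ}

lemma topSum_zero (f : Fin n → ℝ) : topSum 0 f = 0 := by
  simp [topSum]

lemma topSum_succ {k : ℕ} (hk : k < n) (f : Fin n → ℝ) :
    topSum (k + 1) f = topSum k f + f ⟨k, hk⟩ := by
  have h : (Finset.univ.filter fun i : Fin n => (i : ℕ) < k + 1) =
      insert ⟨k, hk⟩ (Finset.univ.filter fun i : Fin n => (i : ℕ) < k) := by
    ext i
    simp only [Finset.mem_filter, Finset.mem_univ, true_and, Finset.mem_insert, Fin.ext_iff]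
    omega
  rw [topSum, h, Finset.sum_insert (by simp), add_comm, topSum]

lemma topSum_const {k : ℕ} (hk : k ≤ n) (c : ℝ) : topSum k (fun _ : Fin n => c) = k * c := by
  induction k with
  | zero => simp [topSum_zero]
  | succ k ih =>
    rw [topSum_succ hk, ih (by omega)]
    push_cast
    ring

lemma topSum_mono (k : ℕ) {f g : Fin n → ℝ} (h : ∀ i : Fin n, (i : ℕ) < k → f i ≤ g i) :
    topSum k f ≤ topSum k g :=
  Finset.sum_le_sum fun i hi => h i (Finset.mem_filter.1 hi).2

lemma topSum_add (k : ℕ) (f g : Fin n → ℝ) :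
    topSum k (fun i => f i + g i) = topSum k f + topSum k g :=
  Finset.sum_add_distrib

lemma topSum_sub (k : ℕ) (f g : Fin n → ℝ) :
    topSum k (fun i => f i - g i) = topSum k f - topSum k g :=
  Finset.sum_sub_distrib _ _

lemma mul_topSum (k : ℕ) (c : ℝ) (f : Fin n → ℝ) :
    topSum k (fun i => c * f i) = c * topSum k f :=
  (Finset.mul_sum _ _ _).symm

lemma topSum_neg (k : ℕ) (f : Fin n → ℝ) : topSum k (fun i => -f i) = -topSum k f :=
  Finset.sum_neg_distrib _

lemma topSum_le_sum (k : ℕ) {f : Fin n → ℝ} (hf : ∀ i, 0 ≤ f i) : topSum k f ≤ ∑ i, f i :=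
  Finset.sum_le_sum_of_subset_of_nonneg (Finset.filter_subset _ _) fun i _ _ => hf i

lemma sum_le_topSum_add {k : ℕ} (hk : k ≤ n) {f : Fin n → ℝ} {c : ℝ}
    (h : ∀ i : Fin n, k ≤ i → f i ≤ c) : ∑ i, f i ≤ topSum k f + ((n : ℝ) - k) * c := by
  have hc : topSum k (fun _ : Fin n => c) + ∑ i with ¬ ((i : Fin n) : ℕ) < k, c = n * c := by
    rw [topSum, Finset.sum_filter_add_sum_filter_not]
    simp
  rw [topSum_const hk] at hc
  have hle : ∑ i with ¬ ((i : Fin n) : ℕ) < k, f i ≤ ∑ i with ¬ ((i : Fin n) : ℕ) < k, c :=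
    Finset.sum_le_sum fun i hi => h i (not_lt.1 (Finset.mem_filter.1 hi).2)
  rw [← Finset.sum_filter_add_sum_filter_not Finset.univ (fun i : Fin n => (i : ℕ) < k) f]
  change topSum k f + _ ≤ _
  linarith

/-- Abel summation with an antitone weight. -/
lemma mul_topSum_succ_le {k : ℕ} (hk : k < n) {w d : Fin n → ℝ}
    (hw : ∀ i j : Fin n, i ≤ j → (j : ℕ) ≤ k → w j ≤ w i)
    (hd : ∀ j ≤ k, 0 ≤ topSum j d) :
    w ⟨k, hk⟩ * topSum (k + 1) d ≤ topSum (k + 1) (fun i => w i * d i) := by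
  induction k with
  | zero => simp [topSum_succ hk, topSum_zero]
  | succ k ih =>
    have hk' : k < n := by omega
    have h1 := ih hk' (fun i j hij hj => hw i j hij (by omega)) fun j hj => hd j (by omega)
    have h2 : w ⟨k + 1, hk⟩ ≤ w ⟨k, hk'⟩ := hw _ _ (by simp [Fin.le_def]) le_rfl
    have h3 := mul_le_mul_of_nonneg_right h2 (hd (k + 1) le_rfl)
    rw [topSum_succ hk, topSum_succ hk (fun i => w i * d i), mul_add]
    linarith

lemma topSum_mul_nonneg {k : ℕ} (hk : k ≤ n) {w d : Fin n → ℝ}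
    (hw : ∀ i j : Fin n, i ≤ j → (j : ℕ) < k → w j ≤ w i)
    (hw0 : ∀ i : Fin n, (i : ℕ) < k → 0 ≤ w i) (hd : ∀ j ≤ k, 0 ≤ topSum j d) :
    0 ≤ topSum k (fun i => w i * d i) := by
  cases k with
  | zero => simp [topSum_zero]
  | succ k =>
    exact (mul_nonneg (hw0 ⟨k, hk⟩ (Nat.lt_succ_self k)) (hd _ le_rfl)).trans <|
      mul_topSum_succ_le hk (fun i j hij hj => hw i j hij (by omega)) fun j hj => hd j (by omega)

lemma topSum_mulVec_le {D : Matrix (Fin n) (Fin n) ℝ} (hD : D ∈ doublyStochastic ℝ (Fin n))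
    {y : Fin n → ℝ} (hy : Antitone y) {j : ℕ} (hj : j ≤ n) :
    topSum j (D.mulVec y) ≤ topSum j y := by
  cases j with
  | zero => simp [topSum_zero]
  | succ j =>
    set c := y ⟨j, hj⟩
    set p : Fin n → ℝ := fun m => topSum (j + 1) (fun i => D i m)
    set q : Fin n → ℝ := fun m => if (m : ℕ) < j + 1 then 1 else 0
    have hp0 : ∀ m, 0 ≤ p m := fun m =>
      Finset.sum_nonneg fun i _ => nonneg_of_mem_doublyStochastic hD
    have hp1 : ∀ m, p m ≤ 1 := fun m =>
      (topSum_le_sum _ fun i => nonneg_of_mem_doublyStochastic hD).trans_eq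
        (sum_col_of_mem_doublyStochastic hD m)
    have hpy : topSum (j + 1) (D.mulVec y) = ∑ m, p m * y m := by
      simp only [topSum, Matrix.mulVec, dotProduct, p, Finset.sum_mul]
      exact Finset.sum_comm
    have hps : ∑ m, p m = ((j + 1 : ℕ) : ℝ) * 1 := by
      rw [← topSum_const hj]
      simp only [topSum, p]
      rw [Finset.sum_comm]
      exact Finset.sum_congr rfl fun i _ => sum_row_of_mem_doublyStochastic hD i
    have hqy : topSum (j + 1) y = ∑ m, q m * y m := by
      simp [topSum, q, Finset.sum_filter]
    have hqs : ∑ m, q m = ((j + 1 : ℕ) : ℝ) * 1 := by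
      rw [← topSum_const hj, topSum, Finset.sum_filter]
    have hpos : 0 ≤ ∑ m, (q m - p m) * (y m - c) := by
      refine Finset.sum_nonneg fun m _ => ?_
      by_cases hm : (m : ℕ) < j + 1
      · have hc : c ≤ y m := hy (Fin.le_def.2 (Nat.lt_succ_iff.1 hm))
        have := hp1 m
        simp only [q, if_pos hm]
        exact mul_nonneg (by linarith) (by linarith)
      · have hc : y m ≤ c := hy (Fin.le_def.2 (by simp only; omega))
        have := hp0 m
        simp only [q, if_neg hm]
        exact mul_nonneg_of_nonpos_of_nonpos (by linarith) (by linarith)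
    have hexp : ∑ m, (q m - p m) * (y m - c) =
        ∑ m, q m * y m - ∑ m, p m * y m - c * (∑ m, q m - ∑ m, p m) := by
      simp only [mul_sub, Finset.mul_sum, ← Finset.sum_sub_distrib]
      exact Finset.sum_congr rfl fun m _ => by ring
    rw [hpy, hqy]
    rw [hexp, hqs, hps] at hpos
    linarith

end topSum

section Karamata

open Set

lemma ConvexOn.exists_monotoneOn_subgradient {S : Set ℝ} {f : ℝ → ℝ} (hf : ConvexOn ℝ S f)
    (hS : IsOpen S) :
    ∃ c : ℝ → ℝ, MonotoneOn c S ∧ ∀ x ∈ S, ∀ y ∈ S, f x + c x * (y - x) ≤ f y := by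
  have hint := hS.interior_eq
  refine ⟨fun x => derivWithin f (Ioi x) x, ?_, fun x hx y hy => ?_⟩
  · simpa [hint] using hf.monotoneOn_rightDeriv
  · have hx' : x ∈ interior S := hint.symm ▸ hx
    rcases lt_trichotomy x y with h | rfl | h
    · have := hf.rightDeriv_le_slope_of_mem_interior hx' hy h
      rw [slope_def_field, le_div_iff₀ (sub_pos.2 h)] at this
      linarith
    · simp
    · have h1 := hf.slope_le_leftDeriv_of_mem_interior hy hx' h
      have h2 := h1.trans (hf.leftDeriv_le_rightDeriv_of_mem_interior hx')
      rw [slope_def_field, div_le_iff₀ (sub_pos.2 h)] at h2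
      linarith

variable {n k : ℕ} {f : ℝ → ℝ} {x y : Fin n → ℝ} {r s m : ℝ}

/-- Karamata's inequality for sequences whose tail is a constant of weight `m`. -/
lemma topSum_add_mul_le_of_isOpen {S : Set ℝ} (hf : ConvexOn ℝ S f) (hS : IsOpen S)
    (hk : k ≤ n) (hm : 0 ≤ m)
    (hx : Antitone x) (hxr : ∀ i : Fin n, (i : ℕ) < k → r ≤ x i)
    (hxS : ∀ i, x i ∈ S) (hyS : ∀ i, y i ∈ S) (hr : r ∈ S) (hs : s ∈ S)
    (hle : ∀ j ≤ k, topSum j x ≤ topSum j y)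
    (hsum : topSum k x + m * r = topSum k y + m * s) :
    topSum k (fun i => f (x i)) + m * f r ≤ topSum k (fun i => f (y i)) + m * f s := by
  obtain ⟨c, hc, hcf⟩ := hf.exists_monotoneOn_subgradient hS
  have habel : 0 ≤ topSum k (fun i => (c (x i) - c r) * (y i - x i)) :=
    topSum_mul_nonneg hk (fun i j hij _ => sub_le_sub_right (hc (hxS j) (hxS i) (hx hij)) _)
      (fun i hi => sub_nonneg.2 (hc hr (hxS i) (hxr i hi)))
      (fun j hj => by rw [topSum_sub]; exact sub_nonneg.2 (hle j hj))
  have htop : topSum k (fun i => f (x i) + c (x i) * (y i - x i)) ≤ topSum k (fun i => f (y i)) :=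
    topSum_mono k fun i _ => hcf _ (hxS i) _ (hyS i)
  have htail := mul_le_mul_of_nonneg_left (hcf r hr s hs) hm
  simp only [sub_mul (c _)] at habel
  rw [topSum_sub, mul_topSum, topSum_sub] at habel
  rw [topSum_add] at htop
  have : c r * (topSum k y - topSum k x) = m * (c r * (r - s)) := by
    linear_combination -c r * hsum
  linarith

lemma topSum_add_mul_le (hf : ConvexOn ℝ (Ici 0) f) (hfc : Continuous f)
    (hk : k ≤ n) (hm : 0 ≤ m)
    (hx : Antitone x) (hxr : ∀ i : Fin n, (i : ℕ) < k → r ≤ x i)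
    (hx0 : ∀ i, 0 ≤ x i) (hy0 : ∀ i, 0 ≤ y i) (hr : 0 ≤ r) (hs : 0 ≤ s)
    (hle : ∀ j ≤ k, topSum j x ≤ topSum j y)
    (hsum : topSum k x + m * r = topSum k y + m * s) :
    topSum k (fun i => f (x i)) + m * f r ≤ topSum k (fun i => f (y i)) + m * f s := by
  have key : ∀ ε ∈ Ioi (0 : ℝ),
      topSum k (fun i => f (x i + ε)) + m * f (r + ε) ≤
        topSum k (fun i => f (y i + ε)) + m * f (s + ε) := by
    intro ε (hε : 0 < ε)
    refine topSum_add_mul_le_of_isOpen (hf.subset Ioi_subset_Ici_self (convex_Ioi 0)) isOpen_Ioi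
      hk hm (hx.add_const ε) (fun i hi => by linarith [hxr i hi])
      (fun i => add_pos_of_nonneg_of_pos (hx0 i) hε)
      (fun i => add_pos_of_nonneg_of_pos (hy0 i) hε)
      (add_pos_of_nonneg_of_pos hr hε) (add_pos_of_nonneg_of_pos hs hε) (fun j hj => ?_) ?_
    · rw [topSum_add, topSum_add]
      linarith [hle j hj]
    · rw [topSum_add, topSum_add]
      linarith
  have hcont : ∀ (z : Fin n → ℝ) (t : ℝ),
      Continuous fun ε => topSum k (fun i => f (z i + ε)) + m * f (t + ε) := by
    intro z t
    unfold topSum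
    fun_prop
  have hlim : ∀ (z : Fin n → ℝ) (t : ℝ),
      Filter.Tendsto (fun ε => topSum k (fun i => f (z i + ε)) + m * f (t + ε))
        (nhdsWithin 0 (Ioi 0)) (nhds (topSum k (fun i => f (z i)) + m * f t)) := by
    intro z t
    simpa using ((hcont z t).tendsto 0).mono_left nhdsWithin_le_nhds
  exact le_of_tendsto_of_tendsto (hlim x r) (hlim y s) (eventually_nhdsWithin_of_forall key)

end Karamata

section eigs

open Matrix

variable {n : ℕ} {A B : Matrix (Fin n) (Fin n) ℝ}

lemma eigs_antitone (A : Matrix (Fin n) (Fin n) ℝ) : Antitone (eigs A) := by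
  unfold eigs
  split_ifs with h
  · exact fun i j hij => Tuple.monotone_sort h.eigenvalues (Fin.rev_le_rev.2 hij)
  · exact antitone_const

lemma eigs_nonneg (hA : A.PosSemidef) (i : Fin n) : 0 ≤ eigs A i := by
  rw [eigs, dif_pos hA.1]
  exact hA.eigenvalues_nonneg _

lemma exists_eq_mul_diagonal_eigs_mul_transpose (hA : A.IsHermitian) :
    ∃ U : Matrix (Fin n) (Fin n) ℝ, Uᵀ * U = 1 ∧ U * Uᵀ = 1 ∧ A = U * diagonal (eigs A) * Uᵀ := by
  let V : Matrix (Fin n) (Fin n) ℝ := hA.eigenvectorUnitary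
  let σ : Equiv.Perm (Fin n) := Fin.revPerm.trans (Tuple.sort hA.eigenvalues)
  have hV1 : Vᵀ * V = 1 := by
    simpa [star_eq_conjTranspose] using Unitary.coe_star_mul_self hA.eigenvectorUnitary
  have hV2 : V * Vᵀ = 1 := by
    simpa [star_eq_conjTranspose] using Unitary.coe_mul_star_self hA.eigenvectorUnitary
  have hVA : A = V * diagonal hA.eigenvalues * Vᵀ := by
    have h := hA.spectral_theorem
    rw [Unitary.conjStarAlgAut_apply] at h
    simpa [star_eq_conjTranspose] using h
  have heigs : eigs A = hA.eigenvalues ∘ σ := by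
    rw [eigs, dif_pos hA]
    rfl
  refine ⟨V.submatrix id σ, ?_, ?_, ?_⟩
  · rw [transpose_submatrix, ← submatrix_mul _ _ _ _ _ Function.bijective_id, hV1,
      submatrix_one_equiv]
  · rw [transpose_submatrix, submatrix_mul_equiv, hV2, submatrix_id_id]
  · rw [heigs, ← submatrix_diagonal_equiv, submatrix_mul_equiv, transpose_submatrix,
      submatrix_mul_equiv, ← hVA, submatrix_id_id]

lemma sum_eigs (hA : A.IsHermitian) : ∑ i, eigs A i = A.trace := by
  obtain ⟨U, hU, -, h⟩ := exists_eq_mul_diagonal_eigs_mul_transpose hA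
  conv_rhs => rw [h, trace_mul_comm, ← Matrix.mul_assoc, hU, Matrix.one_mul, trace_diagonal]

/-- The spectrum of the Hadamard product of `A` with a correlation matrix is majorized by that
of `A`. -/
lemma exists_doublyStochastic_eigs_hadamard (hA : A.IsHermitian) (hB : B.PosSemidef)
    (hdB : ∀ i, B i i = 1) :
    ∃ D ∈ doublyStochastic ℝ (Fin n), eigs (A ⊙ B) = D *ᵥ eigs A := by
  have hC : (A ⊙ B).IsHermitian := by
    ext i j
    simp only [conjTranspose_apply, hadamard_apply, star_mul', hA.apply, hB.1.apply]
  obtain ⟨U, hU1, hU2, hUA⟩ := exists_eq_mul_diagonal_eigs_mul_transpose hA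
  obtain ⟨W, hW1, hW2, hWC⟩ := exists_eq_mul_diagonal_eigs_mul_transpose hC
  have horth {V : Matrix (Fin n) (Fin n) ℝ} (hV : V * Vᵀ = 1) (a b : Fin n) :
      ∑ j, V a j * V b j = if a = b then 1 else 0 := by
    simpa [mul_apply, one_apply] using congrFun (congrFun hV a) b
  have hnorm {V : Matrix (Fin n) (Fin n) ℝ} (hV : Vᵀ * V = 1) (j : Fin n) :
      ∑ a, V a j * V a j = 1 := by
    simpa [mul_apply] using congrFun (congrFun hV j) j
  let D : Matrix (Fin n) (Fin n) ℝ :=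
    of fun i j => ∑ a, ∑ b, (W a i * W b i) * (U a j * U b j) * B a b
  refine ⟨D, mem_doublyStochastic_iff_sum.2 ⟨fun i j => ?_, fun i => ?_, fun j => ?_⟩, ?_⟩
  · have h := hB.dotProduct_mulVec_nonneg fun a => W a i * U a j
    refine h.trans_eq ?_
    simp only [dotProduct, mulVec, D, of_apply, Finset.mul_sum]
    refine Finset.sum_congr rfl fun a _ => Finset.sum_congr rfl fun b _ => ?_
    simp only [Pi.star_apply, star_trivial]
    ring
  · calc ∑ j, D i j = ∑ a, ∑ b, (W a i * W b i) * (∑ j, U a j * U b j) * B a b := by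
          simp only [D, of_apply, Finset.mul_sum, Finset.sum_mul]
          rw [Finset.sum_comm]
          exact Finset.sum_congr rfl fun a _ => Finset.sum_comm
      _ = 1 := by simp [horth hU2, hdB, hnorm hW1]
  · calc ∑ i, D i j = ∑ a, ∑ b, (∑ i, W a i * W b i) * (U a j * U b j) * B a b := by
          simp only [D, of_apply, Finset.sum_mul]
          rw [Finset.sum_comm]
          exact Finset.sum_congr rfl fun a _ => Finset.sum_comm
      _ = 1 := by simp [horth hW2, hdB, hnorm hU1]
  · have hdiag : diagonal (eigs (A ⊙ B)) = Wᵀ * (A ⊙ B) * W := by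
      conv_rhs => rw [hWC]
      rw [Matrix.mul_assoc, Matrix.mul_assoc, hW1, Matrix.mul_one, ← Matrix.mul_assoc, hW1,
        Matrix.one_mul]
    have hAab : ∀ a b, A a b = ∑ j, U a j * eigs A j * U b j := fun a b => by
      conv_lhs => rw [hUA]
      rw [mul_apply]
      simp only [mul_diagonal, transpose_apply]
    funext i
    have hi := congrFun (congrFun hdiag i) i
    rw [diagonal_apply_eq] at hi
    rw [hi, mul_apply]
    simp only [mul_apply, transpose_apply, hadamard_apply, hAab, mulVec, dotProduct, D, of_apply,
      Finset.sum_mul, Finset.mul_sum]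
    rw [Finset.sum_comm]
    conv_rhs => rw [Finset.sum_comm]
    refine Finset.sum_congr rfl fun a _ => ?_
    conv_rhs => rw [Finset.sum_comm]
    exact Finset.sum_congr rfl fun b _ => Finset.sum_congr rfl fun j _ => by ring

end eigs

section Slow

open Matrix

variable {n k : ℕ} {A B : Matrix (Fin n) (Fin n) ℝ}

lemma topSum_eigs_add_lamR (hkn : k < n) (A : Matrix (Fin n) (Fin n) ℝ) :
    topSum k (eigs A) + ((n : ℝ) - k) * lamR k A = 1 := by
  have : (n : ℝ) - k ≠ 0 := sub_ne_zero.2 (by exact_mod_cast hkn.ne')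
  rw [lamR]
  field_simp
  ring

lemma lamR_nonneg (hkn : k < n) (hA : A.PosSemidef) (hA1 : A.trace = 1) : 0 ≤ lamR k A := by
  have hnk : (k : ℝ) < n := by exact_mod_cast hkn
  have h := topSum_le_sum k (eigs_nonneg hA)
  rw [sum_eigs hA.1, hA1] at h
  exact div_nonneg (sub_nonneg.2 h) (sub_pos.2 hnk).le

lemma lamR_le_eigs (hkn : k < n) (hA : A.IsHermitian) (hA1 : A.trace = 1) {i : Fin n}
    (hi : (i : ℕ) < k) : lamR k A ≤ eigs A i := by
  have hnk : (k : ℝ) < n := by exact_mod_cast hkn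
  have h := sum_le_topSum_add hkn.le (f := eigs A) (c := eigs A i)
    fun j hj => eigs_antitone A (Fin.le_def.2 (hi.le.trans hj))
  rw [sum_eigs hA, hA1] at h
  rw [lamR, div_le_iff₀ (sub_pos.2 hnk)]
  linarith

lemma topSum_eigs_rpow_add_pos (hk : 1 ≤ k) (hkn : k < n) (hA : A.PosSemidef)
    (hA1 : A.trace = 1) (α : ℝ) :
    0 < topSum k (fun i => eigs A i ^ α) + ((n : ℝ) - k) * lamR k A ^ α := by
  have hnk : (k : ℝ) < n := by exact_mod_cast hkn
  let i₀ : Fin n := ⟨0, by omega⟩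
  have hi₀ : 0 < eigs A i₀ := by
    by_contra! h
    have hs : ∑ i, eigs A i ≤ 0 :=
      Finset.sum_nonpos fun i _ => (eigs_antitone A (Fin.le_def.2 (Nat.zero_le _))).trans h
    rw [sum_eigs hA.1, hA1] at hs
    linarith
  refine add_pos_of_pos_of_nonneg ?_
    (mul_nonneg (sub_pos.2 hnk).le (Real.rpow_nonneg (lamR_nonneg hkn hA hA1) α))
  exact Finset.sum_pos' (fun i _ => Real.rpow_nonneg (eigs_nonneg hA i) α)
    ⟨i₀, by simp [i₀]; omega, Real.rpow_pos_of_pos hi₀ α⟩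

lemma Slow_le_Slow_hadamard {α : ℝ} (hα : 0 < α) (hα1 : α ≠ 1) (hk : 1 ≤ k) (hkn : k < n)
    (hA : A.PosSemidef) (hA1 : A.trace = 1) (hB : B.PosSemidef) (hdB : ∀ i, B i i = 1) :
    Slow α k A ≤ Slow α k (A ⊙ B) := by
  have hnk : (k : ℝ) < n := by exact_mod_cast hkn
  have hC : (A ⊙ B).PosSemidef := hA.hadamard hB
  have hC1 : (A ⊙ B).trace = 1 := by
    rw [← hA1]
    simp [trace, hdB]
  obtain ⟨D, hD, hDeq⟩ := exists_doublyStochastic_eigs_hadamard hA.1 hB hdB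
  have hle : ∀ j ≤ k, topSum j (eigs (A ⊙ B)) ≤ topSum j (eigs A) := fun j hj => by
    rw [hDeq]
    exact topSum_mulVec_le hD (eigs_antitone A) (hj.trans hkn.le)
  have key : ∀ f : ℝ → ℝ, ConvexOn ℝ (Set.Ici 0) f → Continuous f →
      topSum k (fun i => f (eigs (A ⊙ B) i)) + ((n : ℝ) - k) * f (lamR k (A ⊙ B)) ≤
        topSum k (fun i => f (eigs A i)) + ((n : ℝ) - k) * f (lamR k A) := fun f hf hfc =>
    topSum_add_mul_le hf hfc hkn.le (sub_pos.2 hnk).le (eigs_antitone _)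
      (fun i hi => lamR_le_eigs hkn hC.1 hC1 hi) (eigs_nonneg hC) (eigs_nonneg hA)
      (lamR_nonneg hkn hC hC1) (lamR_nonneg hkn hA hA1) hle
      ((topSum_eigs_add_lamR hkn _).trans (topSum_eigs_add_lamR hkn _).symm)
  have hcont : Continuous fun t : ℝ => t ^ α := Real.continuous_rpow_const hα.le
  rcases lt_or_gt_of_ne hα1 with h | h
  · have h1 := key (fun t => -t ^ α) (Real.concaveOn_rpow hα.le h.le).neg hcont.neg
    simp only [topSum_neg, mul_neg] at h1
    exact mul_le_mul_of_nonneg_left (Real.logb_le_logb_of_le one_lt_two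
      (topSum_eigs_rpow_add_pos hk hkn hA hA1 α) (by linarith))
      (one_div_nonneg.2 (sub_nonneg.2 h.le))
  · exact mul_le_mul_of_nonpos_left (Real.logb_le_logb_of_le one_lt_two
      (topSum_eigs_rpow_add_pos hk hkn hC hC1 α) (key _ (convexOn_rpow h.le) hcont))
      (one_div_nonpos.2 (sub_nonpos.2 h.le))

end Slow

/-- the low-rank Rényi entropy of the normalized Hadamard product dominates
both marginal entropies. -/
theorem lowRank_entropy_hadamard_ge_max {n : ℕ} (A B : Matrix (Fin n) (Fin n) ℝ)
    (α : ℝ) (k : ℕ)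
    (hA : A.PosSemidef) (hB : B.PosSemidef)
    (hdA : ∀ i, A i i = 1 / n) (hdB : ∀ i, B i i = 1 / n)
    (hα : 0 < α) (hα1 : α ≠ 1) (hk1 : 1 ≤ k) (hkn : k ≤ n - 1) :
    max (Slow α k A) (Slow α k B) ≤
      Slow α k ((Matrix.trace (Matrix.hadamard A B))⁻¹ • Matrix.hadamard A B) := by
  have hkn' : k < n := by omega
  have hn : (n : ℝ) ≠ 0 := by exact_mod_cast (by omega : n ≠ 0)
  have htr : (Matrix.trace (Matrix.hadamard A B))⁻¹ = n := by
    simp [Matrix.trace, hdA, hdB, hn]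
  have key : ∀ P Q : Matrix (Fin n) (Fin n) ℝ, P.PosSemidef → Q.PosSemidef →
      (∀ i, P i i = 1 / n) → (∀ i, Q i i = 1 / n) →
      Slow α k P ≤ Slow α k ((n : ℝ) • Matrix.hadamard P Q) := by
    intro P Q hP hQ hdP hdQ
    rw [← Matrix.hadamard_smul]
    exact Slow_le_Slow_hadamard hα hα1 hk1 hkn' hP (by simp [Matrix.trace, hdP, hn])
      (hQ.smul n.cast_nonneg) (by simp [hdQ, hn])
  rw [htr]
  refine max_le (key A B hA hB hdA hdB) ?_
  rw [Matrix.hadamard_comm]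
  exact key B A hB hA hdB hdA
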